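/- Let ℱ be a finite set system on a finite ground set V, with transversal number τ(ℱ), matching number ν(ℱ), and dyadic dual VC-dimension λ(ℱ). Then τ(ℱ) ≤ 11 · λ(ℱ)² · (λ(ℱ) + ν(ℱ) + 3) · (binom(λ(ℱ) + ν(ℱ), λ(ℱ)))². -/

import Mathlib

open Set

/-- The transversal number of a set system `ℱ` on ground set `V`: the smallest
cardinality of a set of points of `V` meeting every member of `ℱ`. -/
noncomputable def transversalNumber {V : Type*} (ℱ : Set (Set V)) : ℕ :=
  sInf {n | ∃ T : Finset V, T.card = n ∧ ∀ F ∈ ℱ, ∃ p ∈ T, p ∈ F}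

/-- The matching number of a set system `ℱ`: the maximum number of pairwise disjoint
members of `ℱ`. -/
noncomputable def matchingNumber {V : Type*} (ℱ : Set (Set V)) : ℕ :=
  sSup {n | ∃ 𝒢 : Finset (Set V), ↑𝒢 ⊆ ℱ ∧ 𝒢.card = n ∧
    (𝒢 : Set (Set V)).Pairwise Disjoint}

/-- The dyadic dual VC-dimension of a set system `ℱ`: the largest `ℓ` for which there
are `F₁, …, F_ℓ ∈ ℱ` and, for each pair `i < j`, a point `a i j ∈ Fᵢ ∩ Fⱼ` lying in no
other `F k`. -/
noncomputable def dyadicDualVC {V : Type*} (ℱ : Set (Set V)) : ℕ :=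
  sSup {ℓ | ∃ (F : Fin ℓ → Set V) (a : Fin ℓ → Fin ℓ → V),
    (∀ i, F i ∈ ℱ) ∧ ∀ i j : Fin ℓ, i < j →
      a i j ∈ F i ∧ a i j ∈ F j ∧ ∀ k : Fin ℓ, k ≠ i → k ≠ j → a i j ∉ F k}

/-- A two-player zero-sum game on the incidences of a finite set system: there is a distribution
on points giving every set mass at least `ε`, or a distribution on sets covering every point
with mass at most `ε`. -/
theorem exists_fractional_transversal_or_matching {E V : Type*} [Fintype E] [Fintype V]
    [Nonempty E] [Nonempty V] (G : E → Set V) (ε : ℝ) :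
    (∃ p ∈ stdSimplex ℝ V, ∀ e, ε ≤ ∑ v, p v * (G e).indicator 1 v) ∨
      ∃ q ∈ stdSimplex ℝ E, ∀ v, ∑ e, q e * (G e).indicator 1 v ≤ ε := by
  classical
  let f : (E → ℝ) → (V → ℝ) → ℝ := fun q p => ∑ e, ∑ v, q e * (p v * (G e).indicator 1 v)
  have f_left : ∀ e p, f (Pi.single e 1) p = ∑ v, p v * (G e).indicator 1 v := by
    intro e p
    simp only [f]
    rw [Finset.sum_eq_single e]
    · simp
    · intro b _ hb; simp [Pi.single_eq_of_ne hb]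
    · simp
  have f_right : ∀ q v, f q (Pi.single v 1) = ∑ e, q e * (G e).indicator 1 v := by
    intro q v
    simp only [f]
    refine Finset.sum_congr rfl fun e _ => ?_
    rw [Finset.sum_eq_single v]
    · simp
    · intro b _ hb; simp [Pi.single_eq_of_ne hb]
    · simp
  have hlin₁ : ∀ p, IsLinearMap ℝ fun q => f q p := fun p =>
    ⟨fun x y => by simp [f, add_mul, Finset.sum_add_distrib],
      fun c x => by simp [f, Finset.mul_sum, mul_assoc]⟩
  have hlin₂ : ∀ q, IsLinearMap ℝ (f q) := fun q =>
    ⟨fun x y => by simp [f, add_mul, mul_add, Finset.sum_add_distrib],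
      fun c x => by simp [f, Finset.mul_sum, mul_assoc, mul_left_comm]⟩
  obtain ⟨a, ha, b, hb, hab⟩ := Sion.exists_isSaddlePointOn (f := f)
    (X := stdSimplex ℝ E) (Y := stdSimplex ℝ V)
    ⟨_, single_mem_stdSimplex ℝ (Classical.arbitrary E)⟩ (convex_stdSimplex ℝ E)
    (isCompact_stdSimplex ℝ E)
    (fun p _ => (Continuous.lowerSemicontinuous (by fun_prop)).lowerSemicontinuousOn _)
    (fun p _ => (((hlin₁ p).mk' _).convexOn (convex_stdSimplex ℝ E)).quasiconvexOn)
    (convex_stdSimplex ℝ V) ⟨_, single_mem_stdSimplex ℝ (Classical.arbitrary V)⟩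
    (isCompact_stdSimplex ℝ V)
    (fun q _ => (Continuous.upperSemicontinuous (by fun_prop)).upperSemicontinuousOn _)
    (fun q _ => (((hlin₂ q).mk' _).concaveOn (convex_stdSimplex ℝ V)).quasiconcaveOn)
  rcases le_total ε (f a b) with h | h
  · refine Or.inl ⟨b, hb, fun e => ?_⟩
    rw [← f_left]
    exact h.trans (hab _ (single_mem_stdSimplex ℝ e) _ hb)
  · refine Or.inr ⟨a, ha, fun v => ?_⟩
    rw [← f_right]
    exact (hab _ ha _ (single_mem_stdSimplex ℝ v)).trans h

/-- The Erdős–Szekeres bound for two-colour Ramsey numbers. -/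
theorem exists_clique_or_independent_of_choose_le_card {α : Type*} (r : α → α → Prop)
    (hr : ∀ ⦃x y⦄, r x y → r y x) (a b : ℕ) (S : Finset α) (hS : (a + b).choose a ≤ S.card) :
    (∃ T ⊆ S, T.card = a + 1 ∧ (T : Set α).Pairwise r) ∨
      ∃ T ⊆ S, T.card = b + 1 ∧ (T : Set α).Pairwise fun x y => ¬ r x y := by
  classical
  have hS₀ : S.Nonempty := Finset.card_pos.1 <|
    (Nat.choose_pos (Nat.le_add_right a b)).trans_le hS
  obtain ⟨x, hx⟩ := hS₀
  induction a generalizing b S x with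
  | zero => exact Or.inl ⟨{x}, by simpa, by simp, by simp⟩
  | succ a iha =>
    induction b generalizing S x with
    | zero => exact Or.inr ⟨{x}, by simpa, by simp, by simp⟩
    | succ b ihb =>
      have hcard := Finset.card_filter_add_card_filter_not (s := S.erase x) (r x)
      rw [Finset.card_erase_of_mem hx] at hcard
      have hch : (a + 1 + (b + 1)).choose (a + 1)
          = (a + (b + 1)).choose a + (a + 1 + b).choose (a + 1) := by
        rw [show a + 1 + (b + 1) = (a + 1 + b) + 1 by ring, Nat.choose_succ_succ,
          show a + 1 + b = a + (b + 1) by ring]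
      have hp₁ : 0 < (a + (b + 1)).choose a := Nat.choose_pos (by omega)
      have hp₂ : 0 < (a + 1 + b).choose (a + 1) := Nat.choose_pos (by omega)
      have key : (a + (b + 1)).choose a ≤ ((S.erase x).filter (r x)).card ∨
          (a + 1 + b).choose (a + 1) ≤ ((S.erase x).filter fun y => ¬ r x y).card := by
        omega
      rcases key with h | h
      · obtain ⟨y, hy⟩ := Finset.card_pos.1 (hp₁.trans_le h)
        rcases iha (b + 1) _ h y hy with ⟨T, hT, hc, hp⟩ | ⟨T, hT, hc, hp⟩
        · have hxT : x ∉ T := fun h => by simpa using hT h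
          refine Or.inl ⟨insert x T, ?_, by rw [Finset.card_insert_of_notMem hxT, hc], ?_⟩
          · exact Finset.insert_subset hx fun z hz => by have := hT hz; simp at this; tauto
          · rw [Finset.coe_insert]
            refine hp.insert fun z hz _ => ?_
            have h' : r x z := by have := hT hz; simp at this; tauto
            exact ⟨h', hr h'⟩
        · exact Or.inr ⟨T, fun z hz => by have := hT hz; simp at this; tauto, hc, hp⟩
      · obtain ⟨y, hy⟩ := Finset.card_pos.1 (hp₂.trans_le h)
        rcases ihb _ h y hy with ⟨T, hT, hc, hp⟩ | ⟨T, hT, hc, hp⟩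
        · exact Or.inl ⟨T, fun z hz => by have := hT hz; simp at this; tauto, hc, hp⟩
        · have hxT : x ∉ T := fun h => by simpa using hT h
          refine Or.inr ⟨insert x T, ?_, by rw [Finset.card_insert_of_notMem hxT, hc], ?_⟩
          · exact Finset.insert_subset hx fun z hz => by have := hT hz; simp at this; tauto
          · rw [Finset.coe_insert]
            refine hp.insert fun z hz _ => ?_
            have h' : ¬ r x z := by have := hT hz; simp at this; tauto
            exact ⟨h', fun h'' => h' (hr h'')⟩

/-- Resampling one coordinate of a product distribution does not change expectations. -/
theorem sum_prod_mul_eq_sum_resample {ι E : Type*} [Fintype ι] [DecidableEq ι] [Fintype E]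
    {q : E → ℝ} (hq : ∑ e, q e = 1) (k : ι) (φ : (ι → E) → ℝ) :
    ∑ f : ι → E, (∏ i, q (f i)) * φ f =
      ∑ f : ι → E, (∏ i, q (f i)) * ∑ e, q e * φ (Function.update f k e) := by
  have hinv : Function.Involutive
      fun fe : (ι → E) × E => (Function.update fe.1 k fe.2, fe.1 k) := by
    rintro ⟨f, e⟩; simp
  have hw : ∀ (f : ι → E) (e : E),
      (∏ i, q (Function.update f k e i)) * q (f k) = (∏ i, q (f i)) * q e := by
    intro f e
    rw [← Finset.mul_prod_erase _ _ (Finset.mem_univ k),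
      ← Finset.mul_prod_erase _ (fun i => q (f i)) (Finset.mem_univ k),
      Finset.prod_congr rfl fun i hi => by
        rw [Function.update_of_ne (Finset.ne_of_mem_erase hi)]]
    simp only [Function.update_self]
    ring
  calc ∑ f : ι → E, (∏ i, q (f i)) * φ f
      = ∑ fe : (ι → E) × E, (∏ i, q (fe.1 i)) * q fe.2 * φ fe.1 := by
        rw [Fintype.sum_prod_type]
        refine Finset.sum_congr rfl fun f _ => ?_
        dsimp only
        rw [← Finset.sum_mul, ← Finset.mul_sum, hq, mul_one]
    _ = ∑ fe : (ι → E) × E, (∏ i, q (fe.1 i)) * q fe.2 * φ (Function.update fe.1 k fe.2) := by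
        rw [← Equiv.sum_comp hinv.toPerm]
        refine Finset.sum_congr rfl fun fe _ => ?_
        simp only [Function.Involutive.coe_toPerm]
        rw [hw]
    _ = _ := by
        rw [Fintype.sum_prod_type]
        refine Finset.sum_congr rfl fun f _ => ?_
        rw [Finset.mul_sum]
        exact Finset.sum_congr rfl fun e _ => by ring

/-- The product of a probability vector with itself is a probability vector. -/
theorem sum_prod_eq_one {ι E : Type*} [Fintype ι] [DecidableEq ι] [Fintype E]
    {q : E → ℝ} (hq : ∑ e, q e = 1) : ∑ f : ι → E, ∏ i, q (f i) = 1 := by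
  rw [← Fintype.prod_sum fun _ : ι => q]
  simp [hq]

/-- Deletion method: if every point is covered with mass at most `1 / (4 n ^ 2)`, there are `2 n`
sets (with repetition) of which some `n` avoid all points chosen for pairs of others. -/
theorem exists_sample_avoiding {E V : Type*} [Fintype E] (G : E → Set V)
    {q : E → ℝ} (hq : q ∈ stdSimplex ℝ E) {n : ℕ} (hn : 0 < n)
    (hcov : ∀ v, ∑ e, q e * (G e).indicator 1 v ≤ 1 / (4 * n ^ 2 : ℝ)) (pt : E → E → V) :
    ∃ (f : Fin (2 * n) → E) (S : Finset (Fin (2 * n))), n ≤ S.card ∧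
      ∀ i ∈ S, ∀ j ∈ S, ∀ k ∈ S, i < j → k ≠ i → k ≠ j → pt (f i) (f j) ∉ G (f k) := by
  classical
  let P : Finset (Fin (2 * n) × Fin (2 * n) × Fin (2 * n)) :=
    Finset.univ.filter fun t => t.1 < t.2.1 ∧ t.2.2 ≠ t.1 ∧ t.2.2 ≠ t.2.1
  have hP : P.card ≤ 4 * n ^ 3 := by
    let Q : Finset (Fin (2 * n) × Fin (2 * n)) := Finset.univ.filter fun t => t.1 < t.2
    have hQ : Q.card + Q.card ≤ (2 * n) * (2 * n) := by
      have h₁ : (Q.map (Equiv.prodComm _ _).toEmbedding).card = Q.card := Finset.card_map _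
      have h₂ : Disjoint Q (Q.map (Equiv.prodComm _ _).toEmbedding) := by
        rw [Finset.disjoint_left]
        rintro ⟨i, j⟩ h h'
        simp [Q] at h h'
        omega
      nth_rewrite 2 [← h₁]
      rw [← Finset.card_union_of_disjoint h₂]
      exact (Finset.card_le_univ _).trans (by simp)
    have hPQ : P.card ≤ (Q ×ˢ (Finset.univ : Finset (Fin (2 * n)))).card := by
      refine Finset.card_le_card_of_injOn (fun t => ((t.1, t.2.1), t.2.2)) ?_ ?_
      · intro t ht
        simp [P] at ht
        simp [Q, ht.1]
      · rintro ⟨i, j, k⟩ _ ⟨i', j', k'⟩ _ h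
        simp at h ⊢
        tauto
    rw [Finset.card_product, Finset.card_univ, Fintype.card_fin] at hPQ
    nlinarith
  let w : (Fin (2 * n) → E) → ℝ := fun f => ∏ i, q (f i)
  have hw₀ : ∀ f, 0 ≤ w f := fun f => Finset.prod_nonneg fun i _ => hq.1 _
  have hw₁ : ∑ f, w f = 1 := sum_prod_eq_one hq.2
  let bad : (Fin (2 * n) → E) → Finset (Fin (2 * n) × Fin (2 * n) × Fin (2 * n)) :=
    fun f => P.filter fun t => pt (f t.1) (f t.2.1) ∈ G (f t.2.2)
  have hE : ∑ f, w f * ((bad f).card : ℝ) ≤ n := by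
    have h₁ : ∀ f, ((bad f).card : ℝ) =
        ∑ t ∈ P, (G (f t.2.2)).indicator 1 (pt (f t.1) (f t.2.1)) := by
      intro f
      simp [bad, Set.indicator_apply]
    simp_rw [h₁, Finset.mul_sum]
    rw [Finset.sum_comm]
    have h₂ : ∀ t ∈ P, ∑ f, w f * (G (f t.2.2)).indicator 1 (pt (f t.1) (f t.2.1)) ≤
        1 / (4 * n ^ 2 : ℝ) := by
      intro t ht
      simp only [P, Finset.mem_filter, Finset.mem_univ, true_and] at ht
      rw [sum_prod_mul_eq_sum_resample hq.2 t.2.2]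
      calc _ ≤ ∑ f, w f * (1 / (4 * n ^ 2 : ℝ)) := by
            refine Finset.sum_le_sum fun f _ => mul_le_mul_of_nonneg_left ?_ (hw₀ f)
            simp only [Function.update_self, Function.update_of_ne ht.2.1.symm,
              Function.update_of_ne ht.2.2.symm]
            exact hcov _
        _ = _ := by rw [← Finset.sum_mul, hw₁, one_mul]
    refine (Finset.sum_le_sum h₂).trans ?_
    rw [Finset.sum_const, nsmul_eq_mul, mul_one_div, div_le_iff₀ (by positivity)]
    have : (P.card : ℝ) ≤ 4 * n ^ 3 := by exact_mod_cast hP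
    linarith
  obtain ⟨f, hf⟩ : ∃ f, (bad f).card ≤ n := by
    by_contra! h
    have : ∑ f, w f * (n + 1 : ℝ) ≤ ∑ f, w f * ((bad f).card : ℝ) :=
      Finset.sum_le_sum fun f _ => mul_le_mul_of_nonneg_left (by exact_mod_cast h f) (hw₀ f)
    rw [← Finset.sum_mul, hw₁] at this
    linarith
  refine ⟨f, Finset.univ \ (bad f).image fun t => t.2.2, ?_, ?_⟩
  · have h₁ := Finset.le_card_sdiff ((bad f).image fun t => t.2.2) Finset.univ
    have h₂ : ((bad f).image fun t => t.2.2).card ≤ _ := Finset.card_image_le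
    rw [Finset.card_univ, Fintype.card_fin] at h₁
    omega
  · intro i _ j _ k hk hij hki hkj hmem
    simp only [Finset.mem_sdiff, Finset.mem_univ, true_and, Finset.mem_image, not_exists] at hk
    exact hk (i, j, k) ⟨by simp [bad, P, hij, hki, hkj, hmem], rfl⟩

/-- A Sauer–Shelah type bound: a set system whose members cannot realise all pairwise private
intersections of `ℓ` sets has few traces on a finite family of points. -/
theorem card_traces_lt {E V κ : Type*} [Fintype E] [Fintype κ] [DecidableEq κ] (G : E → Set V)
    (ℓ : ℕ) (hℓ : ¬ ∃ (F : Fin ℓ → E) (a : Fin ℓ → Fin ℓ → V), ∀ i j : Fin ℓ, i < j →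
      a i j ∈ G (F i) ∧ a i j ∈ G (F j) ∧ ∀ k : Fin ℓ, k ≠ i → k ≠ j → a i j ∉ G (F k))
    (hκ : 2 ≤ Fintype.card κ) (z : κ → V) (𝒜 : Finset (Finset κ))
    (h𝒜 : ∀ A ∈ 𝒜, ∃ e, ∀ t, t ∈ A ↔ z t ∈ G e) :
    𝒜.card < Fintype.card κ ^ ℓ.choose 2 := by
  classical
  have hsh : ∀ S ∈ 𝒜.shatterer, S.card < ℓ.choose 2 := by
    intro S hS
    rw [Finset.mem_shatterer] at hS
    by_contra! hcard
    apply hℓ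
    let P : Finset (Finset (Fin ℓ)) := Finset.univ.powersetCard 2
    have hP : P.card = ℓ.choose 2 := by simp [P]
    have hne : Nonempty (P ↪ S) := by
      rw [Function.Embedding.nonempty_iff_card_le]
      simpa [hP] using hcard
    obtain ⟨g⟩ := hne
    have hmem : ∀ i j : Fin ℓ, i < j → {i, j} ∈ P := by
      intro i j hij
      simp [P, Finset.mem_powersetCard, Finset.card_pair hij.ne]
    have hF : ∀ k : Fin ℓ, ∃ e, ∀ s : P, z (g s) ∈ G e ↔ k ∈ (s : Finset (Fin ℓ)) := by
      intro k
      obtain ⟨A, hA, hSA⟩ := hS (t := (Finset.univ.filter fun s : P => k ∈ s.1).image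
        fun s => (g s : κ)) (by
          intro t ht
          simp only [Finset.mem_image] at ht
          obtain ⟨s, _, rfl⟩ := ht
          exact (g s).2)
      obtain ⟨e, he⟩ := h𝒜 A hA
      refine ⟨e, fun s => ?_⟩
      rw [← he]
      have : (g s : κ) ∈ A ↔ (g s : κ) ∈ S ∩ A := by simp
      rw [this, hSA]
      simp only [Finset.mem_image, Finset.mem_filter, Finset.mem_univ, true_and]
      constructor
      · rintro ⟨s', hs', h⟩
        rwa [← g.injective (Subtype.ext h)]
      · exact fun h => ⟨s, h, rfl⟩
    choose F hF using hF
    have hκ' : Nonempty κ := Fintype.card_pos_iff.1 (by omega)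
    refine ⟨F, fun i j => if h : i < j then z (g ⟨{i, j}, hmem i j h⟩) else z hκ'.some,
      fun i j hij => ?_⟩
    simp only [dif_pos hij, hF]
    simp
    tauto
  calc 𝒜.card ≤ 𝒜.shatterer.card := Finset.card_le_card_shatterer 𝒜
    _ ≤ ((Finset.range (ℓ.choose 2)).biUnion fun k =>
          (Finset.univ : Finset κ).powersetCard k).card := by
        refine Finset.card_le_card fun S hS => ?_
        simp [hsh S hS]
    _ ≤ ∑ k ∈ Finset.range (ℓ.choose 2), (Fintype.card κ) ^ k := by
        refine Finset.card_biUnion_le.trans (Finset.sum_le_sum fun k _ => ?_)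
        rw [Finset.card_powersetCard, Finset.card_univ]
        exact Nat.choose_le_pow _ _
    _ < _ := Nat.geomSum_lt hκ fun k hk => Finset.mem_range.1 hk

/-- An `ε`-net bound by symmetrisation: if the system has fewer than `(1 + ε) ^ N` traces on any
family of `2 N` points and all sets have mass at least `ε`, then some `N` points meet every set. -/
theorem exists_transversal_of_card_traces_lt {E V : Type*} [Fintype E] [Fintype V]
    (G : E → Set V) {p : V → ℝ} (hp : p ∈ stdSimplex ℝ V) {ε : ℝ} (hε : 0 ≤ ε)
    (hmass : ∀ e, ε ≤ ∑ v, p v * (G e).indicator 1 v) {N : ℕ}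
    (htr : ∀ (z : Fin N × Bool → V) (𝒜 : Finset (Finset (Fin N × Bool))),
      (∀ A ∈ 𝒜, ∃ e, ∀ t, t ∈ A ↔ z t ∈ G e) → (𝒜.card : ℝ) < (1 + ε) ^ N) :
    ∃ x : Fin N → V, ∀ e, ∃ i, x i ∈ G e := by
  classical
  by_contra! hno
  choose miss hmiss using hno
  let w : (Fin N → V) → ℝ := fun x => ∏ i, p (x i)
  have hw₀ : ∀ x, 0 ≤ w x := fun x => Finset.prod_nonneg fun i _ => hp.1 _
  have hw₁ : ∑ x, w x = 1 := by
    change ∑ x : Fin N → V, ∏ i, p (x i) = 1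
    rw [← Fintype.prod_sum fun _ : Fin N => p]
    simp [hp.2]
  let Z := (Fin N → V) × (Fin N → V)
  let W : Z → ℝ := fun z => w z.1 * w z.2
  have hW₀ : ∀ z, 0 ≤ W z := fun z => mul_nonneg (hw₀ _) (hw₀ _)
  have hW₁ : ∑ z, W z = 1 := by
    simp only [W, Z]
    rw [Fintype.sum_prod_type]
    simp [← Finset.mul_sum, hw₁]
  let Φ : Z → ℝ := fun z => ∏ i, (1 + (G (miss z.1)).indicator 1 (z.2 i))
  have hlower : (1 + ε) ^ N ≤ ∑ z, W z * Φ z := by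
    simp only [Z, W, Φ, w]
    rw [Fintype.sum_prod_type]
    calc (1 + ε) ^ N = ∑ x, w x * (1 + ε) ^ N := by rw [← Finset.sum_mul, hw₁, one_mul]
      _ ≤ _ := by
        refine Finset.sum_le_sum fun x _ => ?_
        simp_rw [mul_assoc, ← Finset.mul_sum, ← Finset.prod_mul_distrib]
        refine mul_le_mul_of_nonneg_left ?_ (hw₀ x)
        rw [← Fintype.prod_sum fun (_ : Fin N) v => p v * (1 + (G (miss x)).indicator 1 v),
          Finset.prod_const, Finset.card_univ, Fintype.card_fin]
        refine pow_le_pow_left₀ (by linarith) ?_ N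
        simp only [mul_add, mul_one, Finset.sum_add_distrib, hp.2]
        linarith [hmass (miss x)]
  let swap : (Fin N → Bool) → Z → Z := fun σ z =>
    (fun i => if σ i then z.2 i else z.1 i, fun i => if σ i then z.1 i else z.2 i)
  have hswap : ∀ σ, Function.Involutive (swap σ) := by
    rintro σ ⟨x, y⟩
    refine Prod.ext ?_ ?_ <;> funext i <;> by_cases h : σ i <;> simp [swap, h]
  have hWswap : ∀ σ z, W (swap σ z) = W z := by
    intro σ z
    simp only [W, w, swap, ← Finset.prod_mul_distrib]
    refine Finset.prod_congr rfl fun i _ => ?_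
    by_cases h : σ i <;> simp [h, mul_comm]
  have hsym : ∀ σ, ∑ z, W z * Φ z = ∑ z, W z * Φ (swap σ z) := by
    intro σ
    rw [← Equiv.sum_comp (hswap σ).toPerm]
    simp [hWswap]
  let val : Z → Fin N × Bool → V := fun z t => if t.2 then z.2 t.1 else z.1 t.1
  let trace : Z → E → Finset (Fin N × Bool) := fun z e => Finset.univ.filter fun t => val z t ∈ G e
  let g : Finset (Fin N × Bool) → Fin N → Bool → ℝ := fun A i b =>
    if (i, b) ∈ A then 0 else if (i, !b) ∈ A then 2 else 1
  have hg₀ : ∀ A i b, 0 ≤ g A i b := by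
    intro A i b
    simp only [g]
    split_ifs <;> norm_num
  have hg : ∀ A i, ∑ b, g A i b ≤ 2 := by
    intro A i
    simp only [g, Fintype.sum_bool]
    by_cases h₁ : (i, true) ∈ A <;> by_cases h₂ : (i, false) ∈ A <;> simp [h₁, h₂]; norm_num
  have hpoint : ∀ z σ, Φ (swap σ z) ≤
      ∑ A ∈ Finset.univ.image (trace z), ∏ i, g A i (σ i) := by
    intro z σ
    refine le_trans (le_of_eq ?_) (Finset.single_le_sum
      (f := fun A => ∏ i, g A i (σ i))
      (fun A _ => Finset.prod_nonneg fun i _ => hg₀ _ _ _)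
      (Finset.mem_image_of_mem (trace z) (Finset.mem_univ (miss (swap σ z).1))))
    refine Finset.prod_congr rfl fun i _ => ?_
    have hm := hmiss (swap σ z).1 i
    generalize miss (swap σ z).1 = e at hm ⊢
    cases h : σ i <;> simp [swap, h] at hm <;>
      simp [swap, g, trace, val, h, hm, Set.indicator_apply] <;> split_ifs <;> norm_num
  have hupper : ∀ z, ∑ σ, Φ (swap σ z) ≤ 2 ^ N * (Finset.univ.image (trace z)).card := by
    intro z
    calc ∑ σ, Φ (swap σ z)
        ≤ ∑ σ : Fin N → Bool, ∑ A ∈ Finset.univ.image (trace z), ∏ i, g A i (σ i) :=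
          Finset.sum_le_sum fun σ _ => hpoint z σ
      _ = ∑ A ∈ Finset.univ.image (trace z), ∏ i, ∑ b, g A i b := by
          rw [Finset.sum_comm]
          exact Finset.sum_congr rfl fun A _ => (Fintype.prod_sum _).symm
      _ ≤ ∑ A ∈ Finset.univ.image (trace z), (2 : ℝ) ^ N := by
          refine Finset.sum_le_sum fun A _ => ?_
          refine (Finset.prod_le_prod (fun i _ => Finset.sum_nonneg fun b _ => hg₀ A i b)
            fun i _ => hg A i).trans ?_
          simp
      _ = _ := by rw [Finset.sum_const, nsmul_eq_mul, mul_comm]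
  have hlt : ∀ z, ((Finset.univ.image (trace z)).card : ℝ) < (1 + ε) ^ N := by
    intro z
    refine htr (val z) _ fun A hA => ?_
    obtain ⟨e, _, rfl⟩ := Finset.mem_image.1 hA
    exact ⟨e, fun t => by simp [trace]⟩
  have havg : 2 ^ N * ∑ z, W z * Φ z = ∑ z, W z * ∑ σ, Φ (swap σ z) := by
    simp_rw [Finset.mul_sum]
    rw [Finset.sum_comm]
    simp_rw [← Finset.mul_sum, ← hsym]
    simp
  have hstrict : ∑ z, W z * ∑ σ, Φ (swap σ z) < ∑ z, W z * (2 ^ N * (1 + ε) ^ N) := by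
    have hle : ∀ z, ∑ σ, Φ (swap σ z) < 2 ^ N * (1 + ε) ^ N := fun z =>
      (hupper z).trans_lt (mul_lt_mul_of_pos_left (hlt z) (by positivity))
    obtain ⟨z₀, hz₀⟩ : ∃ z, 0 < W z := by
      by_contra! h
      have := Finset.sum_nonpos fun z (_ : z ∈ Finset.univ) => h z
      linarith
    exact Finset.sum_lt_sum (fun z _ => mul_le_mul_of_nonneg_left (hle z).le (hW₀ z))
      ⟨z₀, Finset.mem_univ _, mul_lt_mul_of_pos_left (hle z₀) hz₀⟩
  rw [← Finset.sum_mul, hW₁, one_mul, ← havg] at hstrict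
  exact absurd (lt_of_mul_lt_mul_left hstrict (by positivity)) (not_lt.2 hlower)

theorem sq_mul_add_three_le (s : ℕ) : s ^ 2 * (s + 3) ≤ 42 * 2 ^ s := by
  rcases Nat.lt_or_ge s 4 with h | h
  · interval_cases s <;> norm_num
  · induction s, h using Nat.le_induction with
    | base => norm_num
    | succ s hs ih => rw [pow_succ 2 s]; nlinarith [mul_le_mul hs hs (by omega) (by omega)]

theorem two_mul_sampleSize_le (l ν : ℕ) (hν : 1 ≤ ν) :
    2 * (4 * (l + ν).choose l ^ 2 * (3 * (l + ν + 3) * (l + 1).choose 2)) ≤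
      2 ^ (3 * (l + ν + 3)) := by
  have hD : 2 * (l + 1).choose 2 ≤ (l + ν) ^ 2 := by
    rw [Nat.choose_two_right]
    have h' := Nat.mul_div_le ((l + 1) * (l + 1 - 1)) 2
    have : (l + 1) * (l + 1 - 1) ≤ (l + ν) * (l + ν) := Nat.mul_le_mul (by omega) (by omega)
    rw [sq]
    omega
  have hs := sq_mul_add_three_le (l + ν)
  have hn : (l + ν).choose l ≤ 2 ^ (l + ν) := Nat.choose_le_two_pow _ _
  generalize (l + ν).choose l = n at *
  generalize (l + 1).choose 2 = D at *
  generalize l + ν = s at *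
  calc _ = 12 * n ^ 2 * ((2 * D) * (s + 3)) := by ring
    _ ≤ 12 * (2 ^ s) ^ 2 * (42 * 2 ^ s) := by
      refine Nat.mul_le_mul ?_ ((Nat.mul_le_mul_right _ hD).trans hs)
      gcongr
    _ = 504 * (2 ^ s) ^ 3 := by ring
    _ ≤ 512 * (2 ^ s) ^ 3 := by gcongr; norm_num
    _ = 2 ^ (3 * (s + 3)) := by rw [← pow_mul, mul_add, pow_add, mul_comm s 3]; norm_num; ring

theorem sampleSize_le (l s n : ℕ) (hl : 2 ≤ l) :
    4 * n ^ 2 * (3 * (s + 3) * (l + 1).choose 2) ≤ 11 * l ^ 2 * (s + 3) * n ^ 2 := by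
  have hD : 2 * (l + 1).choose 2 ≤ (l + 1) * l := by
    rw [Nat.choose_two_right]
    exact Nat.mul_div_le ((l + 1) * (l + 1 - 1)) 2
  have hD' : 12 * (l + 1).choose 2 ≤ 11 * l ^ 2 := by nlinarith
  calc _ = n ^ 2 * (s + 3) * (12 * (l + 1).choose 2) := by ring
    _ ≤ n ^ 2 * (s + 3) * (11 * l ^ 2) := by gcongr
    _ = _ := by ring

/-- An indexed system with `λ ≤ l` and matching number at most `ν` has no distribution covering every point
with small mass. -/
theorem not_exists_fractional_matching {E V : Type*} [Fintype E] [Nonempty V] (G : E → Set V)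
    (l ν : ℕ) (hl : ¬ ∃ (F : Fin (l + 1) → E) (a : Fin (l + 1) → Fin (l + 1) → V),
      ∀ i j, i < j → a i j ∈ G (F i) ∧ a i j ∈ G (F j) ∧
        ∀ k, k ≠ i → k ≠ j → a i j ∉ G (F k))
    (hν : ¬ ∃ F : Fin (ν + 1) → E, Pairwise fun i j => Disjoint (G (F i)) (G (F j))) :
    ¬ ∃ q ∈ stdSimplex ℝ E, ∀ v, ∑ e, q e * (G e).indicator 1 v ≤
      1 / (4 * ((l + ν).choose l : ℝ) ^ 2) := by
  classical
  rintro ⟨q, hq, hcov⟩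
  let pt : E → E → V := fun e e' =>
    if h : (G e ∩ G e').Nonempty then h.some else Classical.arbitrary V
  have hpt : ∀ e e', (G e ∩ G e').Nonempty → pt e e' ∈ G e ∧ pt e e' ∈ G e' := by
    intro e e' h
    simp only [pt, dif_pos h]
    exact h.some_mem
  obtain ⟨f, S, hS, hav⟩ := exists_sample_avoiding G hq
    (Nat.choose_pos (Nat.le_add_right l ν)) hcov pt
  rcases exists_clique_or_independent_of_choose_le_card
    (fun i j => (G (f i) ∩ G (f j)).Nonempty) (fun i j h => by rwa [Set.inter_comm]) l ν S hS with
    ⟨T, hTS, hT, hp⟩ | ⟨T, hTS, hT, hp⟩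
  · let o := T.orderEmbOfFin hT
    have ho : ∀ i, o i ∈ T := fun i => Finset.orderEmbOfFin_mem T hT i
    refine hl ⟨fun i => f (o i), fun i j => pt (f (o i)) (f (o j)), fun i j hij => ?_⟩
    have hij' := hpt _ _ (hp (ho i) (ho j) (o.injective.ne hij.ne))
    exact ⟨hij'.1, hij'.2, fun k hki hkj => hav _ (hTS (ho i)) _ (hTS (ho j)) _ (hTS (ho k))
      (o.lt_iff_lt.2 hij) (o.injective.ne hki) (o.injective.ne hkj)⟩
  · let o := T.orderEmbOfFin hT
    have ho : ∀ i, o i ∈ T := fun i => Finset.orderEmbOfFin_mem T hT i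
    exact hν ⟨fun i => f (o i), fun i j hij => Set.disjoint_iff_inter_eq_empty.2 <|
      Set.not_nonempty_iff_eq_empty.1 (hp (ho i) (ho j) (o.injective.ne hij))⟩

/-- Ding–Seymour–Winkler for indexed systems. -/
theorem exists_transversal_of_not_exists {E V : Type*} [Fintype E] [Fintype V] [Nonempty E]
    [Nonempty V] (G : E → Set V) (l ν : ℕ) (hl₂ : 2 ≤ l) (hν₁ : 1 ≤ ν)
    (hl : ¬ ∃ (F : Fin (l + 1) → E) (a : Fin (l + 1) → Fin (l + 1) → V),
      ∀ i j, i < j → a i j ∈ G (F i) ∧ a i j ∈ G (F j) ∧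
        ∀ k, k ≠ i → k ≠ j → a i j ∉ G (F k))
    (hν : ¬ ∃ F : Fin (ν + 1) → E, Pairwise fun i j => Disjoint (G (F i)) (G (F j))) :
    ∃ T : Finset V, T.card ≤ 11 * l ^ 2 * (l + ν + 3) * (l + ν).choose l ^ 2 ∧
      ∀ e, ∃ v ∈ T, v ∈ G e := by
  classical
  obtain ⟨p, hp, hmass⟩ := (exists_fractional_transversal_or_matching G
    (1 / (4 * ((l + ν).choose l : ℝ) ^ 2))).resolve_right
      (not_exists_fractional_matching G l ν hl hν)
  have hsize := two_mul_sampleSize_le l ν hν₁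
  have hN := sampleSize_le l (l + ν) ((l + ν).choose l) hl₂
  have hn : 0 < (l + ν).choose l := Nat.choose_pos (Nat.le_add_right l ν)
  have hD : 0 < (l + 1).choose 2 := Nat.choose_pos (by omega)
  generalize (l + ν).choose l = n at hmass hsize hN hn
  generalize hu : 3 * (l + ν + 3) = u at hsize hN
  generalize hDdef : (l + 1).choose 2 = D at hsize hN hD
  have hcard : Fintype.card (Fin (4 * n ^ 2 * (u * D)) × Bool) = 2 * (4 * n ^ 2 * (u * D)) := by
    simp [mul_comm]
  have hpos : 0 < 4 * n ^ 2 * (u * D) := by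
    have : 0 < u := by omega
    positivity
  obtain ⟨x, hx⟩ := exists_transversal_of_card_traces_lt G hp (by positivity) hmass
    (N := 4 * n ^ 2 * (u * D)) (fun z 𝒜 h𝒜 => by
      have htr := card_traces_lt G (l + 1) hl (by omega) z 𝒜 h𝒜
      rw [hDdef, hcard] at htr
      have hpow : 𝒜.card < 2 ^ (u * D) := by
        rw [pow_mul]
        exact htr.trans_le (Nat.pow_le_pow_left hsize D)
      have hbern := one_add_mul_le_pow (a := 1 / (4 * (n : ℝ) ^ 2))
        (by linarith [show 0 ≤ 1 / (4 * (n : ℝ) ^ 2) by positivity]) (4 * n ^ 2)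
      have htwo : 1 + ((4 * n ^ 2 : ℕ) : ℝ) * (1 / (4 * (n : ℝ) ^ 2)) = 2 := by
        push_cast
        field_simp
        norm_num
      rw [htwo] at hbern
      rw [pow_mul]
      calc (𝒜.card : ℝ) < 2 ^ (u * D) := by exact_mod_cast hpow
        _ ≤ _ := pow_le_pow_left₀ (by norm_num) hbern _)
  refine ⟨Finset.univ.image x, Finset.card_image_le.trans ?_, fun e => ?_⟩
  · simpa using hN
  · obtain ⟨i, hi⟩ := hx e
    exact ⟨x i, Finset.mem_image_of_mem x (Finset.mem_univ i), hi⟩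

theorem bddAbove_matchingSizes {V : Type*} [Fintype V] (ℱ : Set (Set V)) :
    BddAbove {n | ∃ 𝒢 : Finset (Set V), ↑𝒢 ⊆ ℱ ∧ 𝒢.card = n ∧
      (𝒢 : Set (Set V)).Pairwise Disjoint} := by
  classical
  refine ⟨Fintype.card (Set V), ?_⟩
  rintro n ⟨𝒢, _, rfl, _⟩
  exact Finset.card_le_univ 𝒢

theorem bddAbove_dyadicSizes {V : Type*} [Fintype V] (ℱ : Set (Set V)) :
    BddAbove {ℓ | ∃ (F : Fin ℓ → Set V) (a : Fin ℓ → Fin ℓ → V),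
      (∀ i, F i ∈ ℱ) ∧ ∀ i j : Fin ℓ, i < j →
        a i j ∈ F i ∧ a i j ∈ F j ∧ ∀ k : Fin ℓ, k ≠ i → k ≠ j → a i j ∉ F k} := by
  classical
  refine ⟨Fintype.card (Set V) + 2, ?_⟩
  rintro ℓ ⟨F, a, _, h⟩
  by_contra! hℓ
  have hne : ∀ i j : Fin ℓ, i < j → F i ≠ F j := by
    intro i j hij hF
    obtain ⟨k, hk⟩ : ∃ k, k ∉ ({i, j} : Finset (Fin ℓ)) := by
      by_contra! hall
      have := (Finset.card_le_card fun k _ => hall k : (Finset.univ : Finset (Fin ℓ)).card ≤ _)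
      rw [Finset.card_univ, Fintype.card_fin, Finset.card_pair hij.ne] at this
      omega
    simp only [Finset.mem_insert, Finset.mem_singleton, not_or] at hk
    rcases lt_or_gt_of_ne hk.1 with hki | hik
    · obtain ⟨_, hi, hno⟩ := h k i hki
      exact hno j (Ne.symm hk.2) hij.ne' (hF ▸ hi)
    · obtain ⟨hi, _, hno⟩ := h i k hik
      exact hno j hij.ne' (Ne.symm hk.2) (hF ▸ hi)
  have hinj : Function.Injective F := by
    intro i j hij
    by_contra hij'
    rcases lt_or_gt_of_ne hij' with h' | h'
    · exact hne i j h' hij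
    · exact hne j i h' hij.symm
  have := Fintype.card_le_of_injective F hinj
  rw [Fintype.card_fin] at this
  omega

/-- Ding–Seymour–Winkler: for a finite set system on a finite ground set,
`τ ≤ 11 λ² (λ + ν + 3) (C(λ + ν, λ))²`. -/
theorem transversal_le_dingSeymourWinkler {V : Type*} [Fintype V]
    (ℱ : Set (Set V)) (hfin : ℱ.Finite) :
    transversalNumber ℱ ≤
      11 * (dyadicDualVC ℱ) ^ 2 * (dyadicDualVC ℱ + matchingNumber ℱ + 3) *
        (Nat.choose (dyadicDualVC ℱ + matchingNumber ℱ) (dyadicDualVC ℱ)) ^ 2 := by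
  classical
  rcases ℱ.eq_empty_or_nonempty with rfl | hne
  · have : transversalNumber (∅ : Set (Set V)) ≤ 0 := Nat.sInf_le ⟨∅, by simp⟩
    omega
  by_cases hempty : ∅ ∈ ℱ
  · have : transversalNumber ℱ = 0 := by
      rw [transversalNumber, Nat.sInf_eq_zero]
      refine Or.inr (Set.eq_empty_of_forall_notMem ?_)
      rintro n ⟨T, _, hT⟩
      obtain ⟨p, _, hp⟩ := hT ∅ hempty
      exact hp
    omega
  have hmem : ∀ F ∈ ℱ, F.Nonempty := fun F hF =>
    Set.nonempty_iff_ne_empty.2 fun h => hempty (h ▸ hF)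
  obtain ⟨F₀, hF₀⟩ := hne
  obtain ⟨v₀, hv₀⟩ := hmem F₀ hF₀
  have : Nonempty V := ⟨v₀⟩
  have : Nonempty ℱ := ⟨⟨F₀, hF₀⟩⟩
  have : Fintype ℱ := hfin.fintype
  have hbddν := bddAbove_matchingSizes ℱ
  have hbddl := bddAbove_dyadicSizes ℱ
  have hν₁ : 1 ≤ matchingNumber ℱ :=
    le_csSup hbddν ⟨{F₀}, by simpa using hF₀, by simp, by simp⟩
  have hl₂ : 2 ≤ dyadicDualVC ℱ := by
    refine le_csSup hbddl ⟨fun _ => F₀, fun _ _ => v₀, fun _ => hF₀, fun i j hij =>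
      ⟨hv₀, hv₀, fun k hki hkj => ?_⟩⟩
    omega
  obtain ⟨T, hT, hcover⟩ := exists_transversal_of_not_exists (fun F : ℱ => (F : Set V))
    (dyadicDualVC ℱ) (matchingNumber ℱ) hl₂ hν₁
    (by
      rintro ⟨F, a, h⟩
      have : dyadicDualVC ℱ + 1 ≤ dyadicDualVC ℱ :=
        le_csSup hbddl ⟨fun i => F i, a, fun i => (F i).2, h⟩
      omega)
    (by
      rintro ⟨F, hF⟩
      have hinj : Function.Injective fun i => (F i : Set V) := by
        intro i j hij
        by_contra hne
        have hd : Disjoint (F i : Set V) (F j) := hF hne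
        rw [show (F i : Set V) = F j from hij, disjoint_self] at hd
        exact (hmem _ (F j).2).ne_empty hd
      have : matchingNumber ℱ + 1 ≤ matchingNumber ℱ := by
        refine le_csSup hbddν ⟨Finset.univ.image fun i => (F i : Set V), ?_, ?_, ?_⟩
        · intro A hA
          simp only [Finset.coe_image, Finset.coe_univ, Set.image_univ, Set.mem_range] at hA
          obtain ⟨i, rfl⟩ := hA
          exact (F i).2
        · rw [Finset.card_image_of_injective _ hinj]
          simp
        · intro A hA B hB hAB
          simp only [Finset.coe_image, Finset.coe_univ, Set.image_univ, Set.mem_range] at hA hB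
          obtain ⟨i, rfl⟩ := hA
          obtain ⟨j, rfl⟩ := hB
          exact hF fun h => hAB (by rw [h])
      omega)
  have hle : transversalNumber ℱ ≤ T.card :=
    Nat.sInf_le ⟨T, rfl, fun F hF => hcover ⟨F, hF⟩⟩
  exact hle.trans hT
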